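/- Let X be a Rado complex. If the vertex set V(X) is partitioned into finitely many parts, then the subcomplex of X induced on at least one of these parts is a Rado complex. -/

import Mathlib

/-- An (abstract) simplicial complex with vertices drawn from `ℕ`:
a set of nonempty finite subsets of `ℕ` (the simplexes) closed under
passing to nonempty subsets.  The vertex set `V(X)` is the set of `v`
with `{v}` a simplex. -/
structure SComplex where
  faces : Set (Finset ℕ)
  nonempty_of_mem : ∀ s ∈ faces, s.Nonempty
  down_closed : ∀ s ∈ faces, ∀ t ⊆ s, t.Nonempty → t ∈ faces

namespace SComplex

/-- The vertex set of a simplicial complex. -/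
def vertexSet (X : SComplex) : Set ℕ := {v | {v} ∈ X.faces}

/-- The subcomplex of `X` induced on a set `U` of vertices. -/
def induced (X : SComplex) (U : Set ℕ) : SComplex where
  faces := {s | s ∈ X.faces ∧ (↑s : Set ℕ) ⊆ U}
  nonempty_of_mem := fun s hs => X.nonempty_of_mem s hs.1
  down_closed := fun s hs t hts ht =>
    ⟨X.down_closed s hs.1 t hts ht,
     fun x hx => hs.2 (Finset.mem_coe.mpr (hts (Finset.mem_coe.mp hx)))⟩

/-- The link of a vertex `v`: all simplexes `σ` with `v ∉ σ` and `σ ∪ {v}` a simplex. -/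
def link (X : SComplex) (v : ℕ) : SComplex where
  faces := {s | s ∈ X.faces ∧ v ∉ s ∧ insert v s ∈ X.faces}
  nonempty_of_mem := fun s hs => X.nonempty_of_mem s hs.1
  down_closed := fun s hs t hts ht =>
    ⟨X.down_closed s hs.1 t hts ht,
     fun hv => hs.2.1 (hts hv),
     X.down_closed _ hs.2.2 _ (Finset.insert_subset_insert v hts)
       (Finset.insert_nonempty v t)⟩

/-- `IsIso X Y f` : the map `f` is an isomorphism of simplicial complexes from `X` to `Y`,
i.e. a bijection of the vertex sets which induces a bijection between the sets of simplexes. -/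
def IsIso (X Y : SComplex) (f : ℕ → ℕ) : Prop :=
  Set.BijOn f X.vertexSet Y.vertexSet ∧
    ∀ s : Finset ℕ, (↑s : Set ℕ) ⊆ X.vertexSet → (s ∈ X.faces ↔ s.image f ∈ Y.faces)

/-- Two simplicial complexes are isomorphic. -/
def Isomorphic (X Y : SComplex) : Prop := ∃ f, IsIso X Y f

/-- `X` is universal: every countable simplicial complex is isomorphic to an induced
subcomplex of `X`. -/
def Universal (X : SComplex) : Prop :=
  ∀ Y : SComplex, Y.vertexSet.Countable →
    ∃ U ⊆ X.vertexSet, Isomorphic Y (X.induced U)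

/-- `X` is homogeneous: every isomorphism between finite induced subcomplexes of `X`
extends to an isomorphism of `X` onto itself. -/
def Homogeneous (X : SComplex) : Prop :=
  ∀ U U' : Set ℕ, U.Finite → U'.Finite → U ⊆ X.vertexSet → U' ⊆ X.vertexSet →
    ∀ f : ℕ → ℕ, IsIso (X.induced U) (X.induced U') f →
      ∃ F : ℕ → ℕ, IsIso X X F ∧ Set.EqOn F f U

/-- A Rado complex: a countable simplicial complex which is universal and homogeneous. -/
def IsRado (X : SComplex) : Prop :=
  X.vertexSet.Countable ∧ Universal X ∧ Homogeneous X

/-- The ampleness condition: for every finite `U ⊆ V(X)` and every subcomplex `A` of the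
induced complex `X_U` there is a vertex `v ∈ V(X) - U` with `Lk_X(v) ∩ X_U = A`. -/
def AmpleProp (X : SComplex) : Prop :=
  ∀ U : Set ℕ, U.Finite → U ⊆ X.vertexSet →
    ∀ A : SComplex, A.faces ⊆ (X.induced U).faces →
      ∃ v ∈ X.vertexSet \ U, (X.link v).faces ∩ (X.induced U).faces = A.faces

/-- An ample complex: a countable simplicial complex satisfying the ampleness condition. -/
def IsAmple (X : SComplex) : Prop := X.vertexSet.Countable ∧ AmpleProp X

/-- `L'` is an induced subcomplex of `L`. -/
def IsInduced (L' L : SComplex) : Prop :=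
  L'.faces ⊆ L.faces ∧ ∀ s ∈ L.faces, (↑s : Set ℕ) ⊆ L'.vertexSet → s ∈ L'.faces

end SComplex

namespace SComplex

variable {X Y : SComplex}

lemma mem_vertexSet_induced {U : Set ℕ} {a : ℕ} :
    a ∈ (X.induced U).vertexSet ↔ a ∈ X.vertexSet ∧ a ∈ U := by
  simp [vertexSet, induced]

lemma vertexSet_induced {U : Set ℕ} (hU : U ⊆ X.vertexSet) : (X.induced U).vertexSet = U := by
  ext a
  rw [mem_vertexSet_induced]
  exact ⟨fun h => h.2, fun h => ⟨hU h, h⟩⟩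

/-- A relation between vertices of `Y` and vertices of `X` that is the graph of an isomorphism
between induced subcomplexes of `Y` and `X`. -/
structure IsPartialIso (Y X : SComplex) (R : Set (ℕ × ℕ)) : Prop where
  fst_mem : ∀ p ∈ R, p.1 ∈ Y.vertexSet
  snd_mem : ∀ p ∈ R, p.2 ∈ X.vertexSet
  fst_eq_iff : ∀ p ∈ R, ∀ q ∈ R, p.1 = q.1 ↔ p.2 = q.2
  faces_iff : ∀ q : Finset (ℕ × ℕ), (q : Set (ℕ × ℕ)) ⊆ R →
    (q.image Prod.fst ∈ Y.faces ↔ q.image Prod.snd ∈ X.faces)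

lemma IsPartialIso.swap {R : Set (ℕ × ℕ)} (h : IsPartialIso Y X R) :
    IsPartialIso X Y (Prod.swap ⁻¹' R) where
  fst_mem p hp := h.snd_mem _ hp
  snd_mem p hp := h.fst_mem _ hp
  fst_eq_iff p hp q hq := (h.fst_eq_iff _ hp _ hq).symm
  faces_iff q hq := by
    have := h.faces_iff (q.image Prod.swap) (by
      intro x hx
      obtain ⟨y, hy, rfl⟩ := Finset.mem_image.1 (Finset.mem_coe.1 hx)
      exact hq hy)
    rw [Finset.image_image, Finset.image_image] at this
    exact this.symm

/-- The one-point extension property of ample complexes. -/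
lemma IsPartialIso.exists_extension (hX : X.AmpleProp) {p : Finset (ℕ × ℕ)}
    (hp : IsPartialIso Y X p) {a : ℕ} (ha : a ∈ Y.vertexSet) :
    ∃ p' : Finset (ℕ × ℕ), IsPartialIso Y X p' ∧ p ⊆ p' ∧ ∃ b, (a, b) ∈ p' := by
  by_cases had : ∃ b, (a, b) ∈ p
  · exact ⟨p, hp, subset_rfl, had⟩
  let U : Finset ℕ := p.image Prod.snd
  have hUX : (U : Set ℕ) ⊆ X.vertexSet := by
    intro b hb
    obtain ⟨x, hx, rfl⟩ := Finset.mem_image.1 (Finset.mem_coe.1 hb)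
    exact hp.snd_mem x hx
  let c : Finset ℕ → Finset ℕ := fun t => (p.filter fun x => x.2 ∈ t).image Prod.fst
  have hc : ∀ {t t'}, t ⊆ t' → c t ⊆ c t' := fun h =>
    Finset.image_subset_image (Finset.monotone_filter_right p fun x _ hx => h hx)
  have hc_snd : ∀ q ⊆ p, c (q.image Prod.snd) = q.image Prod.fst := by
    intro q hq
    have : (p.filter fun x => x.2 ∈ q.image Prod.snd) = q := by
      ext x
      simp only [Finset.mem_filter, Finset.mem_image]
      constructor
      · rintro ⟨hx, y, hy, hyx⟩
        have h1 := (hp.fst_eq_iff y (hq hy) x hx).2 hyx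
        rwa [← Prod.ext h1 hyx]
      · exact fun hx => ⟨hq hx, x, hx, rfl⟩
    simp only [c, this]
  have hc_faces : ∀ t ⊆ U, (c t ∈ Y.faces ↔ t ∈ X.faces) := by
    intro t ht
    have h := hp.faces_iff (p.filter fun x => x.2 ∈ t) (by
      intro x hx
      exact (Finset.mem_filter.1 (Finset.mem_coe.1 hx)).1)
    have : (p.filter fun x => x.2 ∈ t).image Prod.snd = t := by
      ext b
      simp only [Finset.mem_image, Finset.mem_filter]
      constructor
      · rintro ⟨x, hx, rfl⟩; exact hx.2
      · intro hb
        obtain ⟨x, hx, rfl⟩ := Finset.mem_image.1 (ht hb)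
        exact ⟨x, ⟨hx, hb⟩, rfl⟩
    rw [this] at h
    exact h
  let A : SComplex :=
    { faces := {t | t ∈ X.faces ∧ t ⊆ U ∧ insert a (c t) ∈ Y.faces}
      nonempty_of_mem := fun s hs => X.nonempty_of_mem s hs.1
      down_closed := fun s hs t hts ht =>
        ⟨X.down_closed s hs.1 t hts ht, hts.trans hs.2.1,
          Y.down_closed _ hs.2.2 _ (Finset.insert_subset_insert a (hc hts))
            (Finset.insert_nonempty _ _)⟩ }
  obtain ⟨v, ⟨hvX, hvU⟩, hv⟩ := hX U U.finite_toSet hUX A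
    (fun s hs => ⟨hs.1, Finset.coe_subset.2 hs.2.1⟩)
  have hvp : ∀ x ∈ p, x.2 ≠ v := fun x hx h =>
    hvU (Finset.mem_coe.2 (Finset.mem_image.2 ⟨x, hx, h⟩))
  have hap : ∀ x ∈ p, x.1 ≠ a := fun x hx h => had ⟨x.2, h ▸ hx⟩
  refine ⟨insert (a, v) p, ⟨?_, ?_, ?_, ?_⟩, Finset.subset_insert _ _, v,
    Finset.mem_insert_self _ _⟩
  · intro x hx
    rcases Finset.mem_insert.1 (Finset.mem_coe.1 hx) with rfl | hx
    · exact ha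
    · exact hp.fst_mem x hx
  · intro x hx
    rcases Finset.mem_insert.1 (Finset.mem_coe.1 hx) with rfl | hx
    · exact hvX
    · exact hp.snd_mem x hx
  · intro x hx y hy
    rcases Finset.mem_insert.1 (Finset.mem_coe.1 hx) with rfl | hx <;>
      rcases Finset.mem_insert.1 (Finset.mem_coe.1 hy) with rfl | hy
    · simp
    · exact iff_of_false (hap y hy).symm (hvp y hy).symm
    · exact iff_of_false (hap x hx) (hvp x hx)
    · exact hp.fst_eq_iff x hx y hy
  · intro q hq
    rw [Finset.coe_subset] at hq
    by_cases hav : (a, v) ∈ q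
    · obtain ⟨r, hr, rfl⟩ : ∃ r, (a, v) ∉ r ∧ insert (a, v) r = q :=
        ⟨q.erase (a, v), Finset.notMem_erase _ _, Finset.insert_erase hav⟩
      have hrp : r ⊆ p := by
        intro x hx
        rcases Finset.mem_insert.1 (hq (Finset.mem_insert_of_mem hx)) with rfl | h
        · exact absurd hx hr
        · exact h
      rw [Finset.image_insert, Finset.image_insert]
      rcases r.eq_empty_or_nonempty with rfl | hne
      · exact iff_of_true ha hvX
      have hrf := hp.faces_iff r (Finset.coe_subset.2 hrp)
      by_cases hrX : r.image Prod.snd ∈ X.faces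
      · have hsub : r.image Prod.snd ⊆ U := Finset.image_subset_image hrp
        have hvr : v ∉ r.image Prod.snd := fun h => hvU (hsub h)
        have key := Set.ext_iff.1 hv (r.image Prod.snd)
        constructor
        · intro h
          exact (key.2 ⟨hrX, hsub, by rwa [hc_snd r hrp]⟩).1.2.2
        · intro h
          have := (key.1 ⟨⟨hrX, hvr, h⟩, hrX, Finset.coe_subset.2 hsub⟩).2.2
          rwa [hc_snd r hrp] at this
      · refine iff_of_false (fun h => hrX (hrf.1 ?_)) (fun h => hrX ?_)
        · exact Y.down_closed _ h _ (Finset.subset_insert _ _) (hne.image _)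
        · exact X.down_closed _ h _ (Finset.subset_insert _ _) (hne.image _)
    · refine hp.faces_iff q fun x hx => ?_
      rcases Finset.mem_insert.1 (hq hx) with rfl | h
      · exact absurd hx hav
      · exact h

/-- Back and forth: a finite partial isomorphism into an ample complex extends to a total one,
which is moreover onto if the source is ample, too. -/
lemma IsPartialIso.exists_total (hX : X.AmpleProp) {p : Finset (ℕ × ℕ)}
    (hp : IsPartialIso Y X p) :
    ∃ R : Set (ℕ × ℕ), IsPartialIso Y X R ∧ (p : Set (ℕ × ℕ)) ⊆ R ∧
      (∀ a ∈ Y.vertexSet, ∃ b, (a, b) ∈ R) ∧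
      (Y.AmpleProp → ∀ b ∈ X.vertexSet, ∃ a, (a, b) ∈ R) := by
  let S := {q : Finset (ℕ × ℕ) // IsPartialIso Y X q}
  let D : ℕ ⊕ ℕ → Order.Cofinal S := Sum.elim
    (fun a =>
      { carrier := {q | a ∈ Y.vertexSet → ∃ b, (a, b) ∈ q.1}
        isCofinal := by
          intro q
          by_cases ha : a ∈ Y.vertexSet
          · obtain ⟨q', hq', hqq', h⟩ := q.2.exists_extension hX ha
            exact ⟨⟨q', hq'⟩, fun _ => h, hqq'⟩
          · exact ⟨q, fun h => absurd h ha, le_rfl⟩ })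
    (fun b =>
      { carrier := {q | Y.AmpleProp → b ∈ X.vertexSet → ∃ a, (a, b) ∈ q.1}
        isCofinal := by
          intro q
          by_cases hb : Y.AmpleProp ∧ b ∈ X.vertexSet
          · have hs : IsPartialIso X Y (q.1.image Prod.swap : Finset (ℕ × ℕ)) := by
              have := q.2.swap
              rwa [← Set.image_swap_eq_preimage_swap, ← Finset.coe_image] at this
            obtain ⟨q', hq', hqq', a, h⟩ := hs.exists_extension hb.1 hb.2
            refine ⟨⟨q'.image Prod.swap, ?_⟩, fun _ _ => ⟨a, ?_⟩, ?_⟩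
            · have := hq'.swap
              rwa [← Set.image_swap_eq_preimage_swap, ← Finset.coe_image] at this
            · exact Finset.mem_image.2 ⟨(b, a), h, rfl⟩
            · intro x hx
              exact Finset.mem_image.2
                ⟨x.swap, hqq' (Finset.mem_image_of_mem _ hx), Prod.swap_swap x⟩
          · exact ⟨q, fun h h' => absurd ⟨h, h'⟩ hb, le_rfl⟩ })
  let I := Order.idealOfCofinals (⟨p, hp⟩ : S) D
  have hpI : (⟨p, hp⟩ : S) ∈ I := Order.mem_idealOfCofinals _ D
  let R : Set (ℕ × ℕ) := {x | ∃ q ∈ I, x ∈ q.1}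
  have hfin : ∀ t : Finset (ℕ × ℕ), (t : Set (ℕ × ℕ)) ⊆ R → ∃ q ∈ I, t ⊆ q.1 := by
    intro t
    induction t using Finset.induction_on with
    | empty => exact fun _ => ⟨_, hpI, Finset.empty_subset _⟩
    | insert x t _ ih =>
      intro h
      rw [Finset.coe_insert, Set.insert_subset_iff] at h
      obtain ⟨q, hq, htq⟩ := ih h.2
      obtain ⟨q', hq', hx⟩ := h.1
      obtain ⟨r, hr, h1, h2⟩ := I.directed q hq q' hq'
      exact ⟨r, hr, Finset.insert_subset (h2 hx) (htq.trans h1)⟩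
  refine ⟨R, ⟨?_, ?_, ?_, ?_⟩, fun x hx => ⟨_, hpI, hx⟩, ?_, ?_⟩
  · rintro x ⟨q, -, hx⟩
    exact q.2.fst_mem x hx
  · rintro x ⟨q, -, hx⟩
    exact q.2.snd_mem x hx
  · intro x hx y hy
    obtain ⟨q, -, hq⟩ := hfin {x, y} (by
      rw [Finset.coe_pair]
      exact Set.pair_subset hx hy)
    exact q.2.fst_eq_iff x (hq (by simp)) y (hq (by simp))
  · intro t ht
    obtain ⟨q, -, hq⟩ := hfin t ht
    exact q.2.faces_iff t (Finset.coe_subset.2 hq)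
  · intro a ha
    obtain ⟨q, hqD, hqI⟩ := Order.cofinal_meets_idealOfCofinals (⟨p, hp⟩ : S) D (Sum.inl a)
    obtain ⟨b, hb⟩ := hqD ha
    exact ⟨b, q, hqI, hb⟩
  · intro hY b hb
    obtain ⟨q, hqD, hqI⟩ := Order.cofinal_meets_idealOfCofinals (⟨p, hp⟩ : S) D (Sum.inr b)
    obtain ⟨a, ha⟩ := hqD hY hb
    exact ⟨a, q, hqI, ha⟩

lemma IsPartialIso.injOn {R : Set (ℕ × ℕ)} (hR : IsPartialIso Y X R) {f : ℕ → ℕ}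
    (hf : ∀ a ∈ Y.vertexSet, (a, f a) ∈ R) : Set.InjOn f Y.vertexSet :=
  fun a ha b hb h => (hR.fst_eq_iff _ (hf a ha) _ (hf b hb)).2 h

lemma IsPartialIso.mem_faces_iff {R : Set (ℕ × ℕ)} (hR : IsPartialIso Y X R) {f : ℕ → ℕ}
    (hf : ∀ a ∈ Y.vertexSet, (a, f a) ∈ R) {s : Finset ℕ} (hs : (s : Set ℕ) ⊆ Y.vertexSet) :
    s ∈ Y.faces ↔ s.image f ∈ X.faces := by
  have := hR.faces_iff (s.image fun a => (a, f a)) (by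
    intro x hx
    obtain ⟨a, ha, rfl⟩ := Finset.mem_image.1 (Finset.mem_coe.1 hx)
    exact hf a (hs ha))
  simpa [Finset.image_image, Function.comp_def] using this

lemma AmpleProp.universal (hX : X.AmpleProp) : X.Universal := by
  intro Y _
  obtain ⟨R, hR, -, htot, -⟩ := IsPartialIso.exists_total (Y := Y) (p := ∅) hX
    ⟨by simp, by simp, by simp, by
      intro q hq
      obtain rfl : q = ∅ := by simpa using hq
      exact iff_of_false (fun h => by simpa using Y.nonempty_of_mem _ h)
        (fun h => by simpa using X.nonempty_of_mem _ h)⟩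
  have : ∀ a, ∃ b, a ∈ Y.vertexSet → (a, b) ∈ R := fun a => by
    by_cases ha : a ∈ Y.vertexSet
    · obtain ⟨b, hb⟩ := htot a ha
      exact ⟨b, fun _ => hb⟩
    · exact ⟨0, fun h => absurd h ha⟩
  choose f hf using this
  have hfX : f '' Y.vertexSet ⊆ X.vertexSet := by
    rintro _ ⟨a, ha, rfl⟩
    exact hR.snd_mem _ (hf a ha)
  refine ⟨f '' Y.vertexSet, hfX, f, ?_, fun s hs => ?_⟩
  · rw [vertexSet_induced hfX]
    exact (hR.injOn hf).bijOn_image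
  · rw [hR.mem_faces_iff hf hs]
    refine (and_iff_left ?_).symm
    rw [Finset.coe_image]
    exact Set.image_mono hs

lemma AmpleProp.homogeneous (hX : X.AmpleProp) : X.Homogeneous := by
  intro U U' hU _ hUX hUX' f hf
  obtain ⟨hbij, hfaces⟩ := hf
  rw [vertexSet_induced hUX] at hbij hfaces
  rw [vertexSet_induced hUX'] at hbij
  let p : Finset (ℕ × ℕ) := hU.toFinset.image fun a => (a, f a)
  have hpU : ∀ x ∈ p, x.1 ∈ U ∧ x.2 = f x.1 := by
    intro x hx
    obtain ⟨a, ha, rfl⟩ := Finset.mem_image.1 hx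
    exact ⟨hU.mem_toFinset.1 ha, rfl⟩
  have hp : IsPartialIso X X p := by
    refine ⟨fun x hx => hUX (hpU x hx).1, fun x hx => ?_, fun x hx y hy => ?_, fun q hq => ?_⟩
    · rw [(hpU x hx).2]
      exact hUX' (hbij.mapsTo (hpU x hx).1)
    · rw [(hpU x hx).2, (hpU y hy).2]
      exact (hbij.injOn.eq_iff (hpU x hx).1 (hpU y hy).1).symm
    · have hq1 : ((q.image Prod.fst : Finset ℕ) : Set ℕ) ⊆ U := by
        intro a ha
        obtain ⟨x, hx, rfl⟩ := Finset.mem_image.1 (Finset.mem_coe.1 ha)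
        exact (hpU x (hq hx)).1
      have hq2 : (q.image Prod.fst).image f = q.image Prod.snd := by
        rw [Finset.image_image]
        exact Finset.image_congr fun x hx => (hpU x (hq hx)).2.symm
      have hq3 : ((q.image Prod.snd : Finset ℕ) : Set ℕ) ⊆ U' := by
        rw [← hq2, Finset.coe_image]
        exact (Set.image_mono hq1).trans hbij.mapsTo.image_subset
      have h := hfaces _ hq1
      rw [hq2] at h
      exact (and_iff_left hq1).symm.trans (h.trans (and_iff_left hq3))
  obtain ⟨R, hR, hpR, htot, honto⟩ := hp.exists_total hX
  have : ∀ a, ∃ b, a ∈ X.vertexSet → (a, b) ∈ R := fun a => by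
    by_cases ha : a ∈ X.vertexSet
    · obtain ⟨b, hb⟩ := htot a ha
      exact ⟨b, fun _ => hb⟩
    · exact ⟨0, fun h => absurd h ha⟩
  choose F hF using this
  refine ⟨F, ⟨⟨fun a ha => hR.snd_mem _ (hF a ha), hR.injOn hF, fun b hb => ?_⟩,
    fun s hs => hR.mem_faces_iff hF hs⟩, fun a ha => ?_⟩
  · obtain ⟨a, hab⟩ := honto hX b hb
    have ha := hR.fst_mem _ hab
    exact ⟨a, ha, (hR.fst_eq_iff _ (hF a ha) _ hab).1 rfl⟩
  · have hm : (a, f a) ∈ p := Finset.mem_image.2 ⟨a, hU.mem_toFinset.2 ha, rfl⟩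
    exact (hR.fst_eq_iff _ (hF a (hUX ha)) _ (hpR hm)).1 rfl

lemma IsAmple.isRado (hX : X.IsAmple) : X.IsRado :=
  ⟨hX.1, hX.2.universal, hX.2.homogeneous⟩

/-- The complex obtained from `X` by adjoining `w` as the apex of a cone over `A`. -/
def adjoinCone (X A : SComplex) (w : ℕ) : SComplex where
  faces := {s | s.Nonempty ∧ (w ∉ s → s ∈ X.faces) ∧
    (w ∈ s → s = {w} ∨ s.erase w ∈ A.faces ∩ X.faces)}
  nonempty_of_mem := fun _ hs => hs.1
  down_closed := by
    rintro s ⟨-, hs1, hs2⟩ t hts ht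
    refine ⟨ht, fun hw => ?_, fun hw => ?_⟩
    · by_cases hws : w ∈ s
      · have hsub : t ⊆ s.erase w := Finset.subset_erase.2 ⟨hts, hw⟩
        rcases hs2 hws with rfl | h
        · rw [Finset.erase_singleton, Finset.subset_empty] at hsub
          exact absurd hsub ht.ne_empty
        · exact X.down_closed _ h.2 _ hsub ht
      · exact X.down_closed _ (hs1 hws) _ hts ht
    · rcases (t.erase w).eq_empty_or_nonempty with he | hne
      · left
        rw [← Finset.insert_erase hw, he]
        rfl
      · right
        have hsub : t.erase w ⊆ s.erase w := Finset.erase_subset_erase w hts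
        rcases hs2 (hts hw) with rfl | h
        · rw [Finset.erase_singleton, Finset.subset_empty] at hsub
          exact absurd hsub hne.ne_empty
        · exact ⟨A.down_closed _ h.1 _ hsub hne, X.down_closed _ h.2 _ hsub hne⟩

lemma mem_faces_adjoinCone {A : SComplex} {w : ℕ} {s : Finset ℕ} (hw : w ∉ s) :
    s ∈ (X.adjoinCone A w).faces ↔ s ∈ X.faces :=
  ⟨fun h => h.2.1 hw, fun h => ⟨X.nonempty_of_mem s h, fun _ => h, fun h' => absurd h' hw⟩⟩

lemma insert_mem_faces_adjoinCone {A : SComplex} {w : ℕ} {s : Finset ℕ} (hw : w ∉ s)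
    (hs : s ∈ X.faces) : insert w s ∈ (X.adjoinCone A w).faces ↔ s ∈ A.faces := by
  constructor
  · intro h
    rcases h.2.2 (Finset.mem_insert_self w s) with h | h
    · obtain ⟨x, hx⟩ := X.nonempty_of_mem s hs
      have hxw : x = w := by
        have := Finset.mem_insert_of_mem (b := w) hx
        rwa [h, Finset.mem_singleton] at this
      exact absurd (hxw ▸ hx) hw
    · rw [Finset.erase_insert hw] at h
      exact h.1
  · intro h
    refine ⟨Finset.insert_nonempty _ _, fun h' => absurd (Finset.mem_insert_self w s) h',
      fun _ => Or.inr ?_⟩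
    rw [Finset.erase_insert hw]
    exact ⟨h, hs⟩

lemma IsRado.isAmple (hX : X.IsRado) : X.IsAmple := by
  obtain ⟨hcount, huniv, hhom⟩ := hX
  refine ⟨hcount, fun U hU hUX A hA => ?_⟩
  obtain ⟨w, hw⟩ := Set.Infinite.exists_notMem_finite Set.infinite_univ hU |>.imp fun _ h => h.2
  let Y := (X.induced U).adjoinCone A w
  have hYU : U ⊆ Y.vertexSet := fun a ha =>
    (mem_faces_adjoinCone (by
      rw [Finset.mem_singleton]
      rintro rfl
      exact hw ha)).2 ⟨hUX ha, by simpa using ha⟩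
  have hYw : w ∈ Y.vertexSet :=
    ⟨Finset.singleton_nonempty w, fun h => absurd (Finset.mem_singleton_self w) h,
      fun _ => Or.inl rfl⟩
  obtain ⟨W, hWX, f, hbij, hfaces⟩ := huniv Y (Set.to_countable _)
  rw [vertexSet_induced hWX] at hbij
  have hfY : ∀ s : Finset ℕ, (s : Set ℕ) ⊆ Y.vertexSet →
      (s ∈ Y.faces ↔ s.image f ∈ X.faces) := fun s hs => by
    refine (hfaces s hs).trans (and_iff_left ?_)
    rw [Finset.coe_image]
    exact (Set.image_mono hs).trans hbij.mapsTo.image_subset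
  have hfUX : f '' U ⊆ X.vertexSet :=
    (Set.image_mono hYU).trans (hbij.mapsTo.image_subset.trans hWX)
  obtain ⟨F, ⟨hFbij, hFfaces⟩, hFf⟩ := hhom U (f '' U) hU (hU.image f) hUX hfUX f (by
    rw [IsIso, vertexSet_induced hUX, vertexSet_induced hfUX]
    refine ⟨(hbij.injOn.mono hYU).bijOn_image, fun s hs => ?_⟩
    rw [← mem_faces_adjoinCone (A := A) (w := w) (fun h => hw (hs h))]
    refine (hfY s (hs.trans hYU)).trans (and_iff_left ?_).symm
    rw [Finset.coe_image]
    exact Set.image_mono hs)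
  obtain ⟨v, hvX, hv⟩ := hFbij.surjOn (hWX (hbij.mapsTo hYw))
  have hvU : v ∉ U := fun h => by
    rw [hFf h] at hv
    exact hw (hbij.injOn (hYU h) hYw hv ▸ h)
  have key : ∀ s ∈ (X.induced U).faces, (insert v s ∈ X.faces ↔ s ∈ A.faces) := by
    intro s hs
    rw [← insert_mem_faces_adjoinCone (A := A) (w := w) (fun h => hw (hs.2 h)) hs,
      hFfaces (insert v s) (by
        rw [Finset.coe_insert]
        exact Set.insert_subset hvX (hs.2.trans hUX)),
      hfY (insert w s) (by
        rw [Finset.coe_insert]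
        exact Set.insert_subset hYw (hs.2.trans hYU)),
      Finset.image_insert, Finset.image_insert, hv,
      Finset.image_congr (hFf.mono hs.2)]
  refine ⟨v, ⟨hvX, hvU⟩, Set.ext fun s => ⟨?_, fun hs => ?_⟩⟩
  · rintro ⟨h1, h2⟩
    exact (key s h2).1 h1.2.2
  · exact ⟨⟨(hA hs).1, fun h => hvU ((hA hs).2 h), (key s (hA hs)).2 hs⟩, hA hs⟩

end SComplex

/-- If the vertex set of a Rado complex is partitioned into finitely
many parts, then the subcomplex induced on at least one part is a Rado complex. -/
theorem rado_partition (X : SComplex) (hX : X.IsRado)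
    (k : ℕ) (P : Fin k → Set ℕ)
    (hdisj : ∀ i j, i ≠ j → Disjoint (P i) (P j))
    (hcover : (⋃ i, P i) = X.vertexSet) :
    ∃ i, (X.induced (P i)).IsRado := by
  have hPX : ∀ i, P i ⊆ X.vertexSet := fun i => hcover ▸ Set.subset_iUnion P i
  by_contra! hno
  have hbad : ∀ i, ¬ (X.induced (P i)).AmpleProp := fun i h =>
    hno i (SComplex.IsAmple.isRado ⟨Set.to_countable _, h⟩)
  simp only [SComplex.AmpleProp, not_forall] at hbad
  choose U hU hUP A hA hbad using hbad
  replace hUP : ∀ i, U i ⊆ P i := fun i => by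
    have := hUP i
    rwa [SComplex.vertexSet_induced (hPX i)] at this
  let B : SComplex :=
    { faces := {s | ∃ i, s ∈ (A i).faces}
      nonempty_of_mem := fun s ⟨i, hi⟩ => (A i).nonempty_of_mem s hi
      down_closed := fun s ⟨i, hi⟩ t hts ht => ⟨i, (A i).down_closed s hi t hts ht⟩ }
  obtain ⟨v, ⟨hvX, hvU⟩, hv⟩ := hX.isAmple.2 (⋃ i, U i) (Set.finite_iUnion hU)
    (Set.iUnion_subset fun i => (hUP i).trans (hPX i)) B (by
      rintro s ⟨i, hi⟩
      exact ⟨(hA i hi).1.1, (hA i hi).2.trans (Set.subset_iUnion U i)⟩)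
  obtain ⟨j, hj⟩ := Set.mem_iUnion.1 (hcover ▸ hvX)
  refine hbad j ⟨v, ⟨?_, fun h => hvU (Set.mem_iUnion_of_mem j h)⟩, Set.ext fun s => ⟨?_, ?_⟩⟩
  · rwa [SComplex.vertexSet_induced (hPX j)]
  · rintro ⟨⟨h1, h2, h3⟩, -, h4⟩
    obtain ⟨i, hi⟩ : s ∈ B.faces := hv ▸
      ⟨⟨h1.1, h2, h3.1⟩, h1.1, h4.trans (Set.subset_iUnion U j)⟩
    obtain ⟨x, hx⟩ := X.nonempty_of_mem s h1.1
    obtain rfl : i = j := by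
      by_contra hij
      exact Set.disjoint_left.1 (hdisj i j hij) (hUP i ((hA i hi).2 hx)) (h1.2 hx)
    exact hi
  · intro hs
    have hsB : s ∈ B.faces := ⟨j, hs⟩
    rw [← hv] at hsB
    obtain ⟨⟨h1, h2, h3⟩, -⟩ := hsB
    refine ⟨⟨(hA j hs).1, h2, h3, ?_⟩, hA j hs⟩
    rw [Finset.coe_insert]
    exact Set.insert_subset hj (hA j hs).1.2
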